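/- arXiv:2006.12311 — 3 statements merged into one kernel-verified Lean document; each statement's English description precedes it below -/
import Mathlib

section
/- Let d be a positive integer, let Λ ∈ ℝ^{d×d} be a positive definite matrix satisfying Λ ⪰ I (i.e., Λ − I is positive semidefinite), and let ψ ∈ ℝ^d satisfy ‖ψ‖₂ ≤ 1. Then ψᵀ Λ⁻¹ ψ ≤ 2 log det(Λ + ψ ψᵀ) − 2 log det(Λ). -/
open Matrix

/-- If `Λ` is positive definite with `Λ ⪰ I` and `‖ψ‖₂ ≤ 1`, then
`ψᵀ Λ⁻¹ ψ ≤ 2 log det(Λ + ψψᵀ) − 2 log det Λ`. -/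
theorem stmt_0 (d : ℕ) (hd : 0 < d) (Λ : Matrix (Fin d) (Fin d) ℝ)
    (hΛ : Λ.PosDef) (hΛI : (Λ - 1).PosSemidef)
    (ψ : Fin d → ℝ) (hψ : Real.sqrt (∑ i, ψ i ^ 2) ≤ 1) :
    ψ ⬝ᵥ Λ⁻¹.mulVec ψ ≤
      2 * Real.log (Λ + vecMulVec ψ ψ).det - 2 * Real.log Λ.det := by
  have hdet : 0 < Λ.det := hΛ.det_pos
  have hu : IsUnit Λ.det := hdet.ne'.isUnit
  have hdetx : (Λ + vecMulVec ψ ψ).det = Λ.det * (1 + ψ ⬝ᵥ Λ⁻¹.mulVec ψ) := by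
    rw [vecMulVec_eq Unit, det_add_replicateCol_mul_replicateRow hu]
    congr 1
    rw [det_unique, Matrix.mul_assoc, ← replicateCol_mulVec]
    simp [Matrix.mul_apply, dotProduct]
  obtain ⟨v, hv⟩ : ∃ v, v = Λ⁻¹.mulVec ψ := ⟨_, rfl⟩
  have hΛv : Λ.mulVec v = ψ := by
    rw [hv, mulVec_mulVec, Matrix.mul_nonsing_inv _ hu, one_mulVec]
  rw [hdetx, ← hv]
  have h1 : 0 ≤ v ⬝ᵥ (Λ - 1).mulVec v := by
    simpa using hΛI.dotProduct_mulVec_nonneg v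
  rw [sub_mulVec, one_mulVec, hΛv, dotProduct_sub, dotProduct_comm v ψ] at h1
  have h2 : 0 ≤ v ⬝ᵥ v := Finset.sum_nonneg fun i _ => mul_self_nonneg _
  have h3 : 0 ≤ (ψ - v) ⬝ᵥ (ψ - v) := Finset.sum_nonneg fun i _ => mul_self_nonneg _
  rw [sub_dotProduct, dotProduct_sub, dotProduct_sub, dotProduct_comm v ψ] at h3
  have h4 : ψ ⬝ᵥ ψ ≤ 1 := by
    have := Real.sqrt_le_one.mp hψ
    simpa [dotProduct, sq] using this
  generalize ψ ⬝ᵥ v = x at *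
  have hx0 : 0 ≤ x := by linarith
  have hx1 : x ≤ 1 := by linarith
  rw [Real.log_mul hdet.ne' (by linarith)]
  have h5 := Real.le_log_one_add_of_nonneg hx0
  have h6 : x / 2 ≤ 2 * x / (x + 2) := by
    rw [div_le_div_iff₀ (by norm_num) (by linarith)]
    nlinarith
  linarith
end

section
/- Let d, m be positive integers, λ > 0, let x₁, …, x_m ∈ ℝ^d satisfy ‖x_j‖₂ ≤ 1 for all j, and let y₁, …, y_m ∈ ℝ satisfy |y_j| ≤ H for all j, where H > 0. Set Λ = λ I + Σ_{j=1}^{m} x_j x_jᵀ (a positive definite matrix) and ω = Λ⁻¹ Σ_{j=1}^{m} x_j y_j. Then ‖ω‖₂ ≤ H · (d m / λ)^{1/2}. -/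
open Matrix

/-- the bound on the ridge-regression parameter. With
`Λ = λI + Σ_j x_j x_jᵀ` and `ω = Λ⁻¹ Σ_j x_j y_j`, if `‖x_j‖₂ ≤ 1` and
`|y_j| ≤ H`, then `‖ω‖₂ ≤ H (d m / λ)^{1/2}`. -/
theorem stmt_6 (d m : ℕ) (hd : 0 < d) (hm : 0 < m) (lam H : ℝ)
    (hlam : 0 < lam) (hH : 0 < H)
    (x : Fin m → Fin d → ℝ) (hx : ∀ j, Real.sqrt (∑ i, x j i ^ 2) ≤ 1)
    (y : Fin m → ℝ) (hy : ∀ j, |y j| ≤ H)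
    (Λ : Matrix (Fin d) (Fin d) ℝ)
    (hΛ : Λ = lam • (1 : Matrix (Fin d) (Fin d) ℝ) +
        ∑ j, vecMulVec (x j) (x j))
    (ω : Fin d → ℝ) (hω : ω = Λ⁻¹.mulVec (∑ j, y j • x j)) :
    Real.sqrt (∑ i, ω i ^ 2) ≤ H * Real.sqrt (d * m / lam) := by
  have key : lam * ∑ i, ω i ^ 2 ≤ m * H ^ 2 := by
    by_cases hu : IsUnit Λ.det
    · have h1 : Λ *ᵥ ω = ∑ j, y j • x j := by
        rw [hω, Matrix.mulVec_mulVec, Matrix.mul_nonsing_inv _ hu, Matrix.one_mulVec]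
      have h2 : ω ⬝ᵥ (Λ *ᵥ ω) = lam * ∑ i, ω i ^ 2 + ∑ j, (ω ⬝ᵥ x j) ^ 2 := by
        rw [hΛ, Matrix.add_mulVec, dotProduct_add, Matrix.smul_mulVec, Matrix.one_mulVec,
          dotProduct_smul, Matrix.sum_mulVec, dotProduct_sum]
        congr 1
        · simp [dotProduct, pow_two]
        · refine Finset.sum_congr rfl fun j _ => ?_
          rw [Matrix.vecMulVec_mulVec, dotProduct_comm (x j) ω]
          simp [pow_two]
      have h3 : ω ⬝ᵥ (Λ *ᵥ ω) = ∑ j, y j * (ω ⬝ᵥ x j) := by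
        rw [h1, dotProduct_sum]
        simp
      have h4 : ∑ j, y j * (ω ⬝ᵥ x j) ≤ ∑ j, (H ^ 2 + (ω ⬝ᵥ x j) ^ 2) := by
        refine Finset.sum_le_sum fun j _ => ?_
        have h5 : y j ^ 2 ≤ H ^ 2 := sq_le_sq' (abs_le.mp (hy j)).1 (abs_le.mp (hy j)).2
        nlinarith [sq_nonneg (y j - ω ⬝ᵥ x j), sq_nonneg (y j), sq_nonneg (ω ⬝ᵥ x j)]
      rw [Finset.sum_add_distrib] at h4
      simp only [Finset.sum_const, Finset.card_univ, Fintype.card_fin, nsmul_eq_mul] at h4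
      linarith
    · have h0 : ω = 0 := by
        rw [hω, Matrix.nonsing_inv_apply_not_isUnit _ hu, Matrix.zero_mulVec]
      simp only [h0, Pi.zero_apply]
      simp
      positivity
  have hd1 : (1 : ℝ) ≤ d := by exact_mod_cast hd
  have h6 : (m : ℝ) * H ^ 2 ≤ d * (m * H ^ 2) :=
    le_mul_of_one_le_left (by positivity) hd1
  rw [← Real.sqrt_sq hH.le, ← Real.sqrt_mul (sq_nonneg H)]
  apply Real.sqrt_le_sqrt
  rw [← mul_div_assoc, le_div_iff₀ hlam]
  linarith
end

section
/- Fix positive integers d and a nonempty set X, a nonempty set A, a function ψ : X × A → ℝ^d with ‖ψ(x,a)‖₂ ≤ 1 for all (x,a), and constants λ > 0, L > 0, B ≥ 0, a fixed β ∈ [0, B], and reals H, h with H − h ≥ 0. Let 𝒱 be the class of all functions V : X → ℝ of the form V(x) = min{ sup_{a∈A} [ ψ(x,a)ᵀ ω + √2 β · (log det(Λ + ψ(x,a) ψ(x,a)ᵀ) − log det(Λ))^{1/2} ], H − h }, ranging over parameters ω ∈ ℝ^d with ‖ω‖₂ ≤ L and symmetric positive definite Λ ∈ ℝ^{d×d}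 with Λ ⪰ λI. Then for every ε > 0 there exists a finite set 𝒩 of functions from X to ℝ such that every V ∈ 𝒱 satisfies sup_{x∈X} |V(x) − Ṽ(x)| ≤ ε for some Ṽ ∈ 𝒩, and log |𝒩| ≤ d · log(1 + 4L/ε) + d² · log(1 + 16 B² d^{1/2} / (ε² λ)). -/
open Matrix

theorem aux_card {E : Type*} [NormedAddCommGroup E] [NormedSpace ℝ E] [FiniteDimensional ℝ E]
    (R δ : ℝ) (hR : 0 ≤ R) (hδ : 0 < δ) (s : Finset E) (hs : ∀ c ∈ s, ‖c‖ ≤ R)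
    (h : ∀ c ∈ s, ∀ e ∈ s, c ≠ e → δ ≤ ‖c - e‖) :
    (s.card : ℝ) ≤ (1 + 2 * R / δ) ^ Module.finrank ℝ E := by
  borelize E
  let μ : MeasureTheory.Measure E := MeasureTheory.Measure.addHaar
  have hδ2 : 0 < δ / 2 := by positivity
  have hρ : 0 < R + δ / 2 := by positivity
  set U := ⋃ c ∈ s, Metric.ball (c : E) (δ / 2) with hU
  have D : Set.Pairwise (s : Set E)
      (Function.onFun Disjoint fun c => Metric.ball (c : E) (δ / 2)) := by
    rintro c hc e he hce
    apply Metric.ball_disjoint_ball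
    rw [dist_eq_norm]
    have := h c hc e he hce
    linarith
  have hsub : U ⊆ Metric.ball (0 : E) (R + δ / 2) := by
    refine Set.iUnion₂_subset fun x hx => ?_
    apply Metric.ball_subset_ball'
    rw [dist_zero_right]
    have := hs x hx
    linarith
  have I : (s.card : ENNReal) * ENNReal.ofReal ((δ / 2) ^ Module.finrank ℝ E)
        * μ (Metric.ball 0 1) ≤
      ENNReal.ofReal ((R + δ / 2) ^ Module.finrank ℝ E) * μ (Metric.ball 0 1) :=
    calc
      _ = μ U := by
        rw [hU, MeasureTheory.measure_biUnion_finset D fun c _ => measurableSet_ball]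
        simp only [μ.addHaar_ball_of_pos _ hδ2]
        simp only [Finset.sum_const, nsmul_eq_mul, mul_assoc]
      _ ≤ μ (Metric.ball (0 : E) (R + δ / 2)) := MeasureTheory.measure_mono hsub
      _ = _ := by simp only [μ.addHaar_ball_of_pos _ hρ]
  have J : (s.card : ENNReal) * ENNReal.ofReal ((δ / 2) ^ Module.finrank ℝ E)
      ≤ ENNReal.ofReal ((R + δ / 2) ^ Module.finrank ℝ E) :=
    (ENNReal.mul_le_mul_iff_left (Metric.measure_ball_pos _ _ zero_lt_one).ne'
      MeasureTheory.measure_ball_lt_top.ne).1 I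
  have K := ENNReal.toReal_le_of_le_ofReal (pow_nonneg hρ.le _) J
  rw [ENNReal.toReal_mul, ENNReal.toReal_natCast, ENNReal.toReal_ofReal (by positivity)] at K
  have e : 1 + 2 * R / δ = (R + δ / 2) / (δ / 2) := by field_simp; ring
  rw [e, div_pow, le_div_iff₀ (by positivity)]
  exact K

theorem aux_net {E : Type*} [NormedAddCommGroup E] [NormedSpace ℝ E] [FiniteDimensional ℝ E]
    (R δ : ℝ) (hR : 0 ≤ R) (hδ : 0 < δ) :
    ∃ s : Finset E, (∀ x, ‖x‖ ≤ R → ∃ y ∈ s, ‖x - y‖ ≤ δ) ∧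
      (s.card : ℝ) ≤ (1 + 2 * R / δ) ^ Module.finrank ℝ E := by
  classical
  let P : ℕ → Prop := fun n => ∃ s : Finset E, s.card = n ∧ (∀ c ∈ s, ‖c‖ ≤ R) ∧
    (∀ c ∈ s, ∀ e ∈ s, c ≠ e → δ ≤ ‖c - e‖)
  let K := ⌊(1 + 2 * R / δ) ^ Module.finrank ℝ E⌋₊
  have hP0 : P 0 := ⟨∅, by simp⟩
  have hPK : ∀ n, P n → n ≤ K := by
    rintro n ⟨s, rfl, h1, h2⟩
    exact Nat.le_floor (aux_card R δ hR hδ s h1 h2)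
  obtain ⟨s, hcard, h1, h2⟩ : P (Nat.findGreatest P K) :=
    Nat.findGreatest_spec (Nat.zero_le _) hP0
  refine ⟨s, ?_, aux_card R δ hR hδ s h1 h2⟩
  intro x hx
  by_contra! hcon
  have hxs : x ∉ s := fun hx' => by
    have := hcon x hx'
    simp at this
    linarith
  have hP1 : P (s.card + 1) := by
    refine ⟨insert x s, Finset.card_insert_of_notMem hxs, ?_, ?_⟩
    · intro c hc
      rcases Finset.mem_insert.1 hc with rfl | hc
      · exact hx
      · exact h1 c hc
    · intro c hc e he hce
      rcases Finset.mem_insert.1 hc with rfl | hc1 <;> rcases Finset.mem_insert.1 he with rfl | he1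
      · exact absurd rfl hce
      · exact (hcon e he1).le
      · rw [norm_sub_rev]; exact (hcon c hc1).le
      · exact h2 c hc1 e he1 hce
  have := Nat.le_findGreatest (hPK _ hP1) hP1
  omega

theorem aux_vecnet {ι : Type*} [Fintype ι] (R δ : ℝ) (hR : 0 ≤ R) (hδ : 0 < δ) :
    ∃ s : Finset (ι → ℝ), (∀ x : ι → ℝ, Real.sqrt (∑ i, x i ^ 2) ≤ R →
        ∃ y ∈ s, Real.sqrt (∑ i, (x i - y i) ^ 2) ≤ δ) ∧
      (s.card : ℝ) ≤ (1 + 2 * R / δ) ^ Fintype.card ι := by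
  classical
  obtain ⟨s, hs, hc⟩ := aux_net (E := EuclideanSpace ℝ ι) R δ hR hδ
  refine ⟨s.image (fun v => (fun i => v i)), ?_, ?_⟩
  · intro x hx
    obtain ⟨y, hy, hxy⟩ := hs (WithLp.toLp 2 x) (by
      rw [EuclideanSpace.norm_eq]; simpa using hx)
    refine ⟨_, Finset.mem_image_of_mem _ hy, ?_⟩
    rw [EuclideanSpace.norm_eq] at hxy
    simpa using hxy
  · rw [finrank_euclideanSpace] at hc
    exact le_trans (by exact_mod_cast Finset.card_image_le) hc

theorem aux_cs {ι : Type*} [Fintype ι] (u v : ι → ℝ) (hu : ∑ i, u i ^ 2 ≤ 1) :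
    |∑ i, u i * v i| ≤ Real.sqrt (∑ i, v i ^ 2) := by
  apply Real.abs_le_sqrt
  have h := Finset.sum_mul_sq_le_sq_mul_sq Finset.univ u v
  have h2 : 0 ≤ ∑ i, v i ^ 2 := Finset.sum_nonneg fun i _ => sq_nonneg _
  nlinarith

theorem aux_sqrtlog (s t : ℝ) (hs : 0 ≤ s) (ht : 0 ≤ t) :
    |Real.sqrt (Real.log (1 + s)) - Real.sqrt (Real.log (1 + t))| ≤ Real.sqrt |s - t| := by
  wlog hst : s ≤ t generalizing s t
  · rw [abs_sub_comm, abs_sub_comm s t]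
    exact this t s ht hs (by linarith)
  have h0 : 0 ≤ Real.log (1 + s) := Real.log_nonneg (by linarith)
  have h1 : Real.log (1 + s) ≤ Real.log (1 + t) := Real.log_le_log (by linarith) (by linarith)
  have h2 : Real.log (1 + t) ≤ Real.log (1 + s) + (t - s) := by
    have e : Real.log (1 + t) - Real.log (1 + s) = Real.log ((1 + t) / (1 + s)) :=
      (Real.log_div (by linarith) (by linarith)).symm
    have h3 := Real.log_le_sub_one_of_pos (x := (1 + t) / (1 + s)) (by positivity)
    have h4 : (1 + t) / (1 + s) - 1 ≤ t - s := by
      have : (1 + t) / (1 + s) - 1 = (t - s) / (1 + s) := by field_simp; ring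
      rw [this]
      exact div_le_self (by linarith) (by linarith)
    linarith
  have hsq := Real.sqrt_le_sqrt h1
  rw [abs_sub_comm, abs_of_nonneg (by linarith), abs_sub_comm, abs_of_nonneg (by linarith)]
  have h5 : Real.sqrt (Real.log (1 + t)) ≤
      Real.sqrt (Real.log (1 + s)) + Real.sqrt (t - s) := by
    rw [Real.sqrt_le_iff]
    refine ⟨by positivity, ?_⟩
    rw [add_sq, Real.sq_sqrt h0, Real.sq_sqrt (by linarith)]
    have : 0 ≤ 2 * Real.sqrt (Real.log (1 + s)) * Real.sqrt (t - s) := by positivity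
    linarith
  linarith

theorem aux_det {d : ℕ} (Λ : Matrix (Fin d) (Fin d) ℝ) (h : Λ.PosDef) (u : Fin d → ℝ) :
    0 ≤ u ⬝ᵥ (Λ⁻¹ *ᵥ u) ∧
    Real.log (Λ + vecMulVec u u).det - Real.log Λ.det = Real.log (1 + u ⬝ᵥ (Λ⁻¹ *ᵥ u)) := by
  have hq : 0 ≤ u ⬝ᵥ (Λ⁻¹ *ᵥ u) := by
    have := h.inv.posSemidef.dotProduct_mulVec_nonneg u
    simpa using this
  refine ⟨hq, ?_⟩
  have hdet := h.det_pos
  have e : (Λ + vecMulVec u u).det = Λ.det * (1 + u ⬝ᵥ (Λ⁻¹ *ᵥ u)) := by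
    rw [vecMulVec_eq Unit, det_add_replicateCol_mul_replicateRow (isUnit_iff_ne_zero.2 hdet.ne')]
    congr 1
    rw [Matrix.mul_assoc, Matrix.det_unique]
    simp [Matrix.mul_apply, dotProduct, mulVec, replicateRow, replicateCol]
  rw [e, Real.log_mul hdet.ne' (by linarith)]
  ring

theorem aux_frob {d : ℕ} (lam : ℝ) (hlam : 0 < lam) (Λ : Matrix (Fin d) (Fin d) ℝ)
    (h : Λ.PosDef) (hl : (Λ - lam • (1 : Matrix (Fin d) (Fin d) ℝ)).PosSemidef) :
    Real.sqrt (∑ p : Fin d × Fin d, (Λ⁻¹ p.1 p.2) ^ 2) ≤ Real.sqrt d / lam := by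
  have hcol : ∀ j, ∑ i, (Λ⁻¹ i j) ^ 2 ≤ 1 / lam ^ 2 := by
    intro j
    set v : Fin d → ℝ := fun i => Λ⁻¹ i j with hv
    have hΛv : Λ *ᵥ v = Pi.single j 1 := by
      have h1 : v = Λ⁻¹ *ᵥ Pi.single j 1 := by
        ext i; simp [hv]
      rw [h1, mulVec_mulVec, mul_nonsing_inv _ (isUnit_iff_ne_zero.2 h.det_pos.ne'), one_mulVec]
    have h2 := hl.dotProduct_mulVec_nonneg v
    rw [sub_mulVec, hΛv, smul_mulVec, one_mulVec] at h2
    simp only [star_trivial, dotProduct_sub, dotProduct_single, mul_one, dotProduct_smul,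
      smul_eq_mul] at h2
    have h3 : v ⬝ᵥ v = ∑ i, v i ^ 2 := by simp [dotProduct, sq]
    rw [h3] at h2
    have h4 : v j ^ 2 ≤ ∑ i, v i ^ 2 :=
      Finset.single_le_sum (f := fun i => v i ^ 2) (fun i _ => sq_nonneg _) (Finset.mem_univ j)
    have h5 : 0 ≤ ∑ i, v i ^ 2 := le_trans (sq_nonneg _) h4
    change ∑ i, v i ^ 2 ≤ _
    generalize ∑ i, v i ^ 2 = S at *
    rw [le_div_iff₀ (by positivity)]
    rcases h5.eq_or_lt with h0 | h0
    · rw [← h0]; simp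
    · have h6 : lam * S ≤ v j := by linarith
      have h7 : (lam * S) ^ 2 ≤ v j ^ 2 := pow_le_pow_left₀ (by positivity) h6 2
      have h8 : S * (S * lam ^ 2) ≤ S * 1 := by nlinarith
      exact le_of_mul_le_mul_left h8 h0
  rw [Real.sqrt_le_iff]
  refine ⟨by positivity, ?_⟩
  rw [Fintype.sum_prod_type_right, div_pow, Real.sq_sqrt (by positivity)]
  calc ∑ j, ∑ i, (Λ⁻¹ i j) ^ 2 ≤ ∑ j : Fin d, 1 / lam ^ 2 := Finset.sum_le_sum fun j _ => hcol j
    _ = _ := by simp [div_eq_mul_inv]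

theorem aux_sup {A : Type*} [Nonempty A] (f g : A → ℝ) (ε c : ℝ) (hf : BddAbove (Set.range f))
    (h : ∀ a, |f a - g a| ≤ ε) : |min (⨆ a, f a) c - min (⨆ a, g a) c| ≤ ε := by
  obtain ⟨K, hK⟩ := hf
  have hf : BddAbove (Set.range f) := ⟨K, hK⟩
  have hg : BddAbove (Set.range g) := by
    refine ⟨K + ε, ?_⟩
    rintro _ ⟨a, rfl⟩
    have h1 := hK ⟨a, rfl⟩
    have h2 := abs_le.1 (h a)
    linarith
  have h1 : (⨆ a, f a) ≤ (⨆ a, g a) + ε := ciSup_le fun a => by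
    have := le_ciSup hg a
    have h2 := abs_le.1 (h a)
    linarith
  have h2 : (⨆ a, g a) ≤ (⨆ a, f a) + ε := ciSup_le fun a => by
    have := le_ciSup hf a
    have h2 := abs_le.1 (h a)
    linarith
  refine le_trans (abs_min_sub_min_le_max _ _ _ _) ?_
  rw [sub_self, abs_zero]
  refine max_le (abs_le.2 ⟨by linarith, by linarith⟩) ?_
  exact le_trans (abs_nonneg _) (h (Classical.arbitrary A))

theorem aux_matnet (d : ℕ) (lam B ε : ℝ) (hlam : 0 < lam) (hB : 0 ≤ B) (hε : 0 < ε) :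
    ∃ s : Finset (Fin d × Fin d → ℝ),
      (∀ x : Fin d × Fin d → ℝ, Real.sqrt (∑ i, x i ^ 2) ≤ Real.sqrt d / lam →
        ∃ y ∈ s, Real.sqrt 2 * B * Real.sqrt (Real.sqrt (∑ i, (x i - y i) ^ 2)) ≤ ε / 2) ∧
      (s.card : ℝ) ≤ (1 + 16 * B ^ 2 * Real.sqrt d / (ε ^ 2 * lam)) ^ (d ^ 2) := by
  rcases hB.eq_or_lt with rfl | hB
  · refine ⟨{0}, ?_, by simp⟩
    intro x _
    refine ⟨0, by simp, ?_⟩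
    simp
    positivity
  · obtain ⟨s, hs, hc⟩ := aux_vecnet (ι := Fin d × Fin d) (Real.sqrt d / lam)
      (ε ^ 2 / (8 * B ^ 2)) (by positivity) (by positivity)
    refine ⟨s, ?_, ?_⟩
    · intro x hx
      obtain ⟨y, hy, hxy⟩ := hs x hx
      refine ⟨y, hy, ?_⟩
      have h1 := Real.sqrt_le_sqrt hxy
      calc _ ≤ Real.sqrt 2 * B * Real.sqrt (ε ^ 2 / (8 * B ^ 2)) := by gcongr
        _ ≤ ε / 2 := by
          apply le_of_sq_le_sq _ (by positivity)
          rw [mul_pow, mul_pow, Real.sq_sqrt (by positivity), Real.sq_sqrt (by positivity)]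
          apply le_of_eq
          field_simp
          norm_num
    · refine hc.trans (le_of_eq ?_)
      rw [Fintype.card_prod, Fintype.card_fin, ← sq]
      congr 2
      field_simp
      ring

/-- covering number of the optimistic value-function class.
For every `ε > 0` there is a finite `ε`-net `𝒩` of the class of functions
`V(x) = min{ sup_a [ψ(x,a)ᵀω + √2 β (log det(Λ + ψψᵀ) − log det Λ)^{1/2}], H−h }`
(ranging over `‖ω‖₂ ≤ L` and symmetric positive definite `Λ ⪰ λI`) with
`log |𝒩| ≤ d log(1 + 4L/ε) + d² log(1 + 16 B² √d / (ε² λ))`. -/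
theorem stmt_7 (d : ℕ) (hd : 0 < d)
    {X A : Type*} [Nonempty X] [Nonempty A]
    (ψ : X × A → Fin d → ℝ) (hψ : ∀ p, Real.sqrt (∑ i, ψ p i ^ 2) ≤ 1)
    (lam L B β H h : ℝ) (hlam : 0 < lam) (hL : 0 < L) (hB : 0 ≤ B)
    (hβ : β ∈ Set.Icc 0 B) (hHh : 0 ≤ H - h) :
    ∀ ε : ℝ, 0 < ε →
      ∃ 𝒩 : Finset (X → ℝ),
        (∀ ω : Fin d → ℝ, ∀ Λ : Matrix (Fin d) (Fin d) ℝ,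
            Real.sqrt (∑ i, ω i ^ 2) ≤ L → Λ.IsSymm → Λ.PosDef →
            (Λ - lam • (1 : Matrix (Fin d) (Fin d) ℝ)).PosSemidef →
            ∃ Vt ∈ 𝒩, ∀ x : X,
              |min (⨆ a : A,
                    (ψ (x, a) ⬝ᵥ ω + Real.sqrt 2 * β *
                      Real.sqrt
                        (Real.log (Λ + vecMulVec (ψ (x, a)) (ψ (x, a))).det -
                          Real.log Λ.det)))
                  (H - h) - Vt x| ≤ ε) ∧
        Real.log 𝒩.card ≤
          d * Real.log (1 + 4 * L / ε) +
            d ^ 2 * Real.log (1 + 16 * B ^ 2 * Real.sqrt d / (ε ^ 2 * lam)) := by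
  intro ε hε
  classical
  obtain ⟨s, hs, hsc⟩ := aux_vecnet (ι := Fin d) L (ε / 2) hL.le (by positivity)
  obtain ⟨t, ht, htc⟩ := aux_matnet d lam B ε hlam hB hε
  let q : (Fin d × Fin d → ℝ) → X × A → ℝ := fun M p =>
    ∑ ij : Fin d × Fin d, (ψ p ij.1 * ψ p ij.2) * M ij
  let F : (Fin d → ℝ) × (Fin d × Fin d → ℝ) → X → ℝ := fun wM x =>
    min (⨆ a : A, (ψ (x, a) ⬝ᵥ wM.1 + Real.sqrt 2 * β *
      Real.sqrt (Real.log (1 + max (q wM.2 (x, a)) 0)))) (H - h)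
  have hψ1 : ∀ p, ∑ i, ψ p i ^ 2 ≤ 1 := by
    intro p
    have := hψ p
    rwa [Real.sqrt_le_one] at this
  have hψ2 : ∀ p, ∑ ij : Fin d × Fin d, (ψ p ij.1 * ψ p ij.2) ^ 2 ≤ 1 := by
    intro p
    have h0 : 0 ≤ ∑ i, ψ p i ^ 2 := Finset.sum_nonneg fun i _ => sq_nonneg _
    have e : ∑ ij : Fin d × Fin d, (ψ p ij.1 * ψ p ij.2) ^ 2
        = (∑ i, ψ p i ^ 2) * (∑ i, ψ p i ^ 2) := by
      rw [Fintype.sum_prod_type, Finset.sum_mul_sum]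
      simp only [mul_pow]
    rw [e]
    exact mul_le_one₀ (hψ1 p) h0 (hψ1 p)
  refine ⟨(s ×ˢ t).image F, ?_, ?_⟩
  · intro ω Λ hω hsymm hpd hpsd
    obtain ⟨w, hw, hww⟩ := hs ω hω
    set M : Fin d × Fin d → ℝ := fun ij => Λ⁻¹ ij.1 ij.2 with hM
    have hfrob := aux_frob lam hlam Λ hpd hpsd
    obtain ⟨M', hM', hMM⟩ := ht M hfrob
    have hq : ∀ p, ψ p ⬝ᵥ (Λ⁻¹ *ᵥ ψ p) = q M p := by
      intro p
      simp only [q, hM, dotProduct, mulVec, Fintype.sum_prod_type, Finset.mul_sum]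
      refine Finset.sum_congr rfl fun i _ => Finset.sum_congr rfl fun j _ => ?_
      ring
    have hq0 : ∀ p, 0 ≤ q M p := fun p => hq p ▸ (aux_det Λ hpd (ψ p)).1
    have hqb : ∀ p, |q M p| ≤ Real.sqrt d / lam := fun p =>
      (aux_cs _ M (hψ2 p)).trans hfrob
    refine ⟨F (w, M'), Finset.mem_image_of_mem _ (Finset.mk_mem_product hw hM'), ?_⟩
    intro x
    have hβ0 := hβ.1
    have hβB := hβ.2
    simp only [(aux_det Λ hpd _).2, hq]
    apply aux_sup
    · refine ⟨L + Real.sqrt 2 * β * Real.sqrt (Real.sqrt d / lam), ?_⟩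
      rintro _ ⟨a, rfl⟩
      have h1 : ψ (x, a) ⬝ᵥ ω ≤ L :=
        (le_abs_self _).trans ((aux_cs _ ω (hψ1 (x, a))).trans hω)
      have h2 : Real.log (1 + q M (x, a)) ≤ Real.sqrt d / lam := by
        have h3 := Real.log_le_sub_one_of_pos (x := 1 + q M (x, a)) (by linarith [hq0 (x, a)])
        linarith [le_abs_self (q M (x, a)), hqb (x, a)]
      have h3 := Real.sqrt_le_sqrt h2
      dsimp only
      gcongr
    · intro a
      have h1 : |ψ (x, a) ⬝ᵥ ω - ψ (x, a) ⬝ᵥ w| ≤ ε / 2 := by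
        rw [← dotProduct_sub]
        exact (aux_cs _ (ω - w) (hψ1 (x, a))).trans hww
      have h2 := aux_sqrtlog (q M (x, a)) (max (q M' (x, a)) 0) (hq0 _) (le_max_right _ _)
      have h3 : |q M (x, a) - max (q M' (x, a)) 0| ≤ Real.sqrt (∑ i, (M i - M' i) ^ 2) := by
        have h4 : |q M (x, a) - q M' (x, a)| ≤ Real.sqrt (∑ i, (M i - M' i) ^ 2) := by
          have e : q M (x, a) - q M' (x, a) = ∑ ij : Fin d × Fin d,
              (ψ (x, a) ij.1 * ψ (x, a) ij.2) * (M ij - M' ij) := by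
            simp only [q, mul_sub, Finset.sum_sub_distrib]
          rw [e]
          exact aux_cs _ (fun i => M i - M' i) (hψ2 (x, a))
        refine le_trans ?_ h4
        nth_rewrite 1 [← max_eq_left (hq0 (x, a))]
        exact abs_max_sub_max_le_abs _ _ _
      have h5 := h2.trans (Real.sqrt_le_sqrt h3)
      have h6 : |Real.sqrt 2 * β * Real.sqrt (Real.log (1 + q M (x, a))) -
          Real.sqrt 2 * β * Real.sqrt (Real.log (1 + max (q M' (x, a)) 0))| ≤ ε / 2 := by
        rw [← mul_sub, abs_mul, abs_of_nonneg (by positivity)]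
        refine le_trans ?_ hMM
        gcongr
      rw [abs_le] at h1 h6 ⊢
      constructor <;> linarith [h1.1, h1.2, h6.1, h6.2]
  · have hLε : 0 < 1 + 4 * L / ε := by positivity
    have hBε : 0 < 1 + 16 * B ^ 2 * Real.sqrt d / (ε ^ 2 * lam) := by positivity
    have hLn : 0 ≤ Real.log (1 + 4 * L / ε) := Real.log_nonneg (by
      have : 0 ≤ 4 * L / ε := by positivity
      linarith)
    have hBn : 0 ≤ Real.log (1 + 16 * B ^ 2 * Real.sqrt d / (ε ^ 2 * lam)) := Real.log_nonneg (by
      have : 0 ≤ 16 * B ^ 2 * Real.sqrt d / (ε ^ 2 * lam) := by positivity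
      linarith)
    rcases Nat.eq_zero_or_pos ((s ×ˢ t).image F).card with h0 | h0
    · rw [h0]
      simp only [Nat.cast_zero, Real.log_zero]
      positivity
    have hc : (((s ×ˢ t).image F).card : ℝ) ≤ (1 + 4 * L / ε) ^ d *
        (1 + 16 * B ^ 2 * Real.sqrt d / (ε ^ 2 * lam)) ^ (d ^ 2) := by
      have h1 : (((s ×ˢ t).image F).card : ℝ) ≤ (s.card : ℝ) * t.card := by
        have := Finset.card_image_le (s := s ×ˢ t) (f := F)
        rw [Finset.card_product] at this
        exact_mod_cast this
      have e : 1 + 2 * L / (ε / 2) = 1 + 4 * L / ε := by field_simp; ring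
      rw [Fintype.card_fin, e] at hsc
      exact h1.trans (mul_le_mul hsc htc (by positivity) (by positivity))
    have := Real.log_le_log (by exact_mod_cast h0) hc
    rw [Real.log_mul (by positivity) (by positivity), Real.log_pow, Real.log_pow] at this
    push_cast at this
    exact this
end
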